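/- arXiv:1807.09107 — 2 statements merged into one kernel-verified Lean document; each statement's English description precedes it below -/
import Mathlib

section
/- Let C = im N ⊆ (F_q^2)^n be an F_q-linear code of dimension k with generator matrix N, and let C|C = {(x|x) : x ∈ C} ⊆ (F_q^2)^{2n} be the concatenated code (with generator matrix N|N). Then rMon(C|C) = rMon(C) and Iso(C|C) = Iso(C) as subgroups of GL_k(F_q). -/
open Matrix

/-- Hamming weight on `(F²)^ι`, blocks indexed by `ι`:
`wt_H(v) = #{i : (v_{i,0}, v_{i,1}) ≠ (0,0)}`. -/
def wtH {F : Type*} [CommRing F] [DecidableEq F] {ι : Type*} [Fintype ι]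
    (v : ι × Fin 2 → F) : ℕ :=
  (Finset.univ.filter fun i : ι =>
    ¬(v (i, (0 : Fin 2)) = 0 ∧ v (i, (1 : Fin 2)) = 0)).card

/-- The symplectic form `⟨x,y⟩ = Σ_i x_i J y_iᵀ` on `(F²)^ι`, `J = [[0,-1],[1,0]]`. -/
def sympFormI {F : Type*} [CommRing F] {ι : Type*} [Fintype ι]
    (v w : ι × Fin 2 → F) : F :=
  ∑ i : ι, (v (i, (1 : Fin 2)) * w (i, (0 : Fin 2)) -
            v (i, (0 : Fin 2)) * w (i, (1 : Fin 2)))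

/-- A monomial map of `(F²)^ι` given by a permutation `σ` of the blocks and a family
of `2×2` matrices `A_i`: block `i` of the output is block `σ(i)` of the input times `A_i`. -/
def monoApply {F : Type*} [CommRing F] {ι : Type*}
    (σ : Equiv.Perm ι) (A : ι → Matrix (Fin 2) (Fin 2) F)
    (v : ι × Fin 2 → F) : ι × Fin 2 → F :=
  fun p => Matrix.vecMul (fun s => v (σ p.1, s)) (A p.1) p.2

/-- The isometry group `Iso(C) = {B ∈ GL_k(F) : wt_H(xBH) = wt_H(xH) ∀x}` of the code
with generator matrix `H`, as a subset of `GL_k(F)`. -/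
def IsoSet {F : Type*} [CommRing F] [DecidableEq F] {k : ℕ} {ι : Type*} [Fintype ι]
    (H : Matrix (Fin k) (ι × Fin 2) F) : Set (Matrix.GeneralLinearGroup (Fin k) F) :=
  {B | ∀ x : Fin k → F,
    wtH (Matrix.vecMul (Matrix.vecMul x (B : Matrix (Fin k) (Fin k) F)) H) =
      wtH (Matrix.vecMul x H)}

/-- `rMon(C)`: those `B ∈ GL_k(F)` such that `xH ↦ xBH` is the restriction to `C` of a
(`GL₂(F)`-) monomial map of the ambient space. -/
def rMonSet {F : Type*} [CommRing F] {k : ℕ} {ι : Type*} [Fintype ι]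
    (H : Matrix (Fin k) (ι × Fin 2) F) : Set (Matrix.GeneralLinearGroup (Fin k) F) :=
  {B | ∃ (σ : Equiv.Perm ι) (A : ι → Matrix (Fin 2) (Fin 2) F),
    (∀ i, IsUnit (A i).det) ∧
    ∀ x : Fin k → F,
      Matrix.vecMul (Matrix.vecMul x (B : Matrix (Fin k) (Fin k) F)) H =
        monoApply σ A (Matrix.vecMul x H)}

/-- `rMon_SL(C)`: those `B ∈ GL_k(F)` such that `xH ↦ xBH` is the restriction to `C`
of an `SL₂(F)`-monomial map of the ambient space. -/
def rMonSLSet {F : Type*} [CommRing F] {k : ℕ} {ι : Type*} [Fintype ι]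
    (H : Matrix (Fin k) (ι × Fin 2) F) : Set (Matrix.GeneralLinearGroup (Fin k) F) :=
  {B | ∃ (σ : Equiv.Perm ι) (A : ι → Matrix (Fin 2) (Fin 2) F),
    (∀ i, (A i).det = 1) ∧
    ∀ x : Fin k → F,
      Matrix.vecMul (Matrix.vecMul x (B : Matrix (Fin k) (Fin k) F)) H =
        monoApply σ A (Matrix.vecMul x H)}

/-- `Hs ⊆ GL_k(F)` is closed with respect to the left action of `GL_k(F)` on the orbit
space `O^#` of the right `GL₂(F)`-multiplication action on `k×2` matrices: `Hs` equals
its closure `{g : g · orb_{Hs}(x) = orb_{Hs}(x) for all x ∈ O^#}` (orbit sets in the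
quotient being identified with their saturated preimages in the matrix space). -/
def ClosedOsharp {F : Type*} [CommRing F] {k : ℕ}
    (Hs : Set (Matrix.GeneralLinearGroup (Fin k) F)) : Prop :=
  ∀ g : Matrix.GeneralLinearGroup (Fin k) F,
    (∀ M : Matrix (Fin k) (Fin 2) F,
      {N : Matrix (Fin k) (Fin 2) F | ∃ B ∈ Hs, ∃ A : Matrix.GeneralLinearGroup (Fin 2) F,
        N = (g : Matrix (Fin k) (Fin k) F) * (B : Matrix (Fin k) (Fin k) F) * M *
            (A : Matrix (Fin 2) (Fin 2) F)} =
      {N : Matrix (Fin k) (Fin 2) F | ∃ B ∈ Hs, ∃ A : Matrix.GeneralLinearGroup (Fin 2) F,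
        N = (B : Matrix (Fin k) (Fin k) F) * M * (A : Matrix (Fin 2) (Fin 2) F)})
    ↔ g ∈ Hs

/-- `Hs ⊆ GL_k(F)` is closed with respect to the right action of `GL_k(F)` on the orbit
space `O` of the scalar `Fˣ`-action on `F^k`:  `Hs` equals its closure
`{g : orb_{Hs}(x) · g = orb_{Hs}(x) for all x ∈ O}`. -/
def ClosedO {F : Type*} [CommRing F] {k : ℕ}
    (Hs : Set (Matrix.GeneralLinearGroup (Fin k) F)) : Prop :=
  ∀ g : Matrix.GeneralLinearGroup (Fin k) F,
    (∀ x : Fin k → F,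
      {y : Fin k → F | ∃ B ∈ Hs, ∃ u : Fˣ,
        y = (u : F) • Matrix.vecMul x
          ((B : Matrix (Fin k) (Fin k) F) * (g : Matrix (Fin k) (Fin k) F))} =
      {y : Fin k → F | ∃ B ∈ Hs, ∃ u : Fˣ,
        y = (u : F) • Matrix.vecMul x (B : Matrix (Fin k) (Fin k) F)})
    ↔ g ∈ Hs

/-- The generator matrix `N|N` of the concatenated code `C|C`, with block index
`Fin n ⊕ Fin n`. -/
def concMat {F : Type*} [CommRing F] {k n : ℕ} (N : Matrix (Fin k) (Fin n × Fin 2) F) :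
    Matrix (Fin k) ((Fin n ⊕ Fin n) × Fin 2) F :=
  fun i p => N i (Sum.elim id id p.1, p.2)

/-- Two families of row vectors of length two are equivalent if one invertible matrix,
acting on the right, carries one to the other. -/
def blockSetoid (X F : Type*) [Field F] : Setoid (X → Fin 2 → F) where
  r f g := ∃ A : Matrix (Fin 2) (Fin 2) F, IsUnit A.det ∧ ∀ x, f x = g x ᵥ* A
  iseqv :=
    { refl := fun f => ⟨1, by simp, fun x => by simp⟩
      symm := by
        rintro f g ⟨A, hA, h⟩
        refine ⟨A⁻¹, Matrix.isUnit_nonsing_inv_det A hA, fun x => ?_⟩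
        rw [h, Matrix.vecMul_vecMul, Matrix.mul_nonsing_inv A hA, Matrix.vecMul_one]
      trans := by
        rintro f g h ⟨A, hA, hf⟩ ⟨B, hB, hg⟩
        refine ⟨B * A, by rw [Matrix.det_mul]; exact hB.mul hA, fun x => ?_⟩
        rw [hf, hg, Matrix.vecMul_vecMul] }

/-- The `GL₂(F)`-class of the `i`-th block of the linear map with matrix `M`. -/
def blockClass {F : Type*} [Field F] {k : ℕ} {ι : Type*}
    (M : Matrix (Fin k) (ι × Fin 2) F) (i : ι) : Quotient (blockSetoid (Fin k → F) F) :=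
  Quotient.mk _ fun x s => (x ᵥ* M) (i, s)

theorem Multiset.map_univ_eq_map_univ_iff {ι Q : Type*} [Fintype ι] (f g : ι → Q) :
    Multiset.map f Finset.univ.val = Multiset.map g Finset.univ.val ↔
      ∃ σ : Equiv.Perm ι, f = g ∘ σ := by
  classical
  constructor
  · intro h
    have e (c : Q) : Nonempty ({i // f i = c} ≃ {i // g i = c}) := by
      have hc := congrArg (Multiset.count c) h
      simp only [Multiset.count_map, ← Finset.filter_val, Finset.card_val] at hc
      refine Fintype.card_eq.mp ?_
      simpa only [Fintype.card_subtype, eq_comm (a := c)] using hc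
    exact ⟨Equiv.ofFiberEquiv fun c => (e c).some,
      funext fun i => (Equiv.ofFiberEquiv_map (fun c => (e c).some) i).symm⟩
  · rintro ⟨σ, rfl⟩
    rw [← Multiset.map_map, Multiset.map_univ_val_equiv]

theorem mem_rMonSet_iff_map_blockClass_eq {F : Type*} [Field F] {k : ℕ} {ι : Type*} [Fintype ι]
    (H : Matrix (Fin k) (ι × Fin 2) F) (B : Matrix.GeneralLinearGroup (Fin k) F) :
    B ∈ rMonSet H ↔
      Multiset.map (blockClass ((B : Matrix (Fin k) (Fin k) F) * H)) Finset.univ.val =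
        Multiset.map (blockClass H) Finset.univ.val := by
  rw [Multiset.map_univ_eq_map_univ_iff]
  refine exists_congr fun σ => ?_
  have key : (blockClass ((B : Matrix (Fin k) (Fin k) F) * H) = blockClass H ∘ σ) ↔
      ∀ i, ∃ A : Matrix (Fin 2) (Fin 2) F, IsUnit A.det ∧
        ∀ x : Fin k → F, (fun s => (x ᵥ* ((B : Matrix (Fin k) (Fin k) F) * H)) (i, s)) =
          (fun s => (x ᵥ* H) (σ i, s)) ᵥ* A := by
    rw [funext_iff]
    exact forall_congr' fun i => Quotient.eq
  rw [key]
  constructor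
  · rintro ⟨A, hA, h⟩ i
    refine ⟨A i, hA i, fun x => ?_⟩
    rw [← Matrix.vecMul_vecMul, h x]
    rfl
  · intro h
    choose A hA h using h
    refine ⟨A, hA, fun x => funext fun p => ?_⟩
    rw [Matrix.vecMul_vecMul]
    exact congrFun (h p.1 x) p.2

theorem Multiset.map_sumElim_id_univ {ι Q : Type*} [Fintype ι] (f : ι → Q) :
    Multiset.map (fun i : ι ⊕ ι => f (Sum.elim id id i)) Finset.univ.val =
      2 • Multiset.map f Finset.univ.val := by
  rw [← Finset.univ_disjSum_univ, Finset.val_disjSum, Multiset.disjSum, Multiset.map_add,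
    Multiset.map_map, Multiset.map_map, two_nsmul]
  rfl

theorem wtH_comp_sumElim_id {F : Type*} [CommRing F] [DecidableEq F] {ι : Type*} [Fintype ι]
    (v : ι × Fin 2 → F) :
    wtH (fun p : (ι ⊕ ι) × Fin 2 => v (Sum.elim id id p.1, p.2)) = 2 * wtH v := by
  simp only [wtH, Finset.card_filter, Fintype.sum_sum_type, Sum.elim_inl, Sum.elim_inr, id, two_mul]
  rfl

theorem rMonSet_concMat {F : Type*} [Field F] {k n : ℕ}
    (N : Matrix (Fin k) (Fin n × Fin 2) F) : rMonSet (concMat N) = rMonSet N := by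
  ext B
  rw [mem_rMonSet_iff_map_blockClass_eq, mem_rMonSet_iff_map_blockClass_eq]
  have h (M : Matrix (Fin k) (Fin n × Fin 2) F) :
      Multiset.map (blockClass (concMat M)) Finset.univ.val =
        2 • Multiset.map (blockClass M) Finset.univ.val :=
    Multiset.map_sumElim_id_univ (blockClass M)
  have hB : (B : Matrix (Fin k) (Fin k) F) * concMat N =
      concMat ((B : Matrix (Fin k) (Fin k) F) * N) := rfl
  rw [hB, h, h]
  exact (nsmul_right_injective two_ne_zero).eq_iff

theorem IsoSet_concMat {F : Type*} [CommRing F] [DecidableEq F] {k n : ℕ}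
    (N : Matrix (Fin k) (Fin n × Fin 2) F) : IsoSet (concMat N) = IsoSet N := by
  have h (x : Fin k → F) : wtH (x ᵥ* concMat N) = 2 * wtH (x ᵥ* N) :=
    wtH_comp_sumElim_id (x ᵥ* N)
  ext B
  simp only [IsoSet, Set.mem_ofPred_eq, h, mul_right_inj' (two_ne_zero (α := ℕ))]

/-- For a `k`-dimensional code `C = im N ⊆ (F_q²)^n`, the concatenated
code `C|C` satisfies `rMon(C|C) = rMon(C)` and `Iso(C|C) = Iso(C)` inside `GL_k(F_q)`. -/
theorem stmt10 {F : Type*} [Field F] [Fintype F] [DecidableEq F] {k n : ℕ}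
    (N : Matrix (Fin k) (Fin n × Fin 2) F)
    (hdim : Function.Injective fun x : Fin k → F => Matrix.vecMul x N) :
    rMonSet (concMat N) = rMonSet N ∧ IsoSet (concMat N) = IsoSet N := by
  exact ⟨rMonSet_concMat N, IsoSet_concMat N⟩
end

section
/- Let R = ℤ/dℤ, let S ≤ P_n be a stabilizer with stabilizer code C = Ψ(S) ⊆ R^{2n}, and let U = U_1 ⊗ ... ⊗ U_n with each U_i ∈ U(d) satisfying U_i P_1 U_i† = P_1 (a local Clifford operator). Then the stabilizer codes C and C_U := Ψ(USU†) are symplectically isometric: there is an R-linear bijection C → C_U preserving the symplectic weight wt_s and the symplectic inner product ⟨·,·⟩_s. -/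
open Matrix

/-- A generating character of a finite commutative ring. -/
def IsGenChar {R : Type*} [CommRing R] [Fintype R] (χ : AddChar R ℂ) : Prop :=
  ∀ ψ : AddChar R ℂ, ∃ r : R, ∀ v : R, ψ v = χ (v * r)

/-- The shift operator `X(a)`:  `X(a) v_x = v_{x+a}`. -/
noncomputable def XM {R : Type*} [CommRing R] [Fintype R] [DecidableEq R] {n : ℕ}
    (a : Fin n → R) : Matrix (Fin n → R) (Fin n → R) ℂ :=
  fun y x => if y = x + a then 1 else 0

/-- The phase operator `Z(b)`:  `Z(b) v_x = χ(b·x) v_x`. -/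
noncomputable def ZM {R : Type*} [CommRing R] [Fintype R] [DecidableEq R] {n : ℕ}
    (χ : AddChar R ℂ) (b : Fin n → R) : Matrix (Fin n → R) (Fin n → R) ℂ :=
  Matrix.diagonal fun x => χ (b ⬝ᵥ x)

/-- The set `P_n = {ω^ℓ X(a)Z(b) : ℓ ∈ ℤ, a, b ∈ R^n}` of Pauli operators. -/
noncomputable def PauliSet {R : Type*} [CommRing R] [Fintype R] [DecidableEq R] {n : ℕ}
    (χ : AddChar R ℂ) (ω : ℂ) : Set (Matrix (Fin n → R) (Fin n → R) ℂ) :=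
  {M | ∃ (ℓ : ℤ) (a b : Fin n → R), M = ω ^ ℓ • (XM a * ZM χ b)}
/-- The one-qudit shift operator `X(a)` on `ℂ^d`. -/
noncomputable def XM1 {R : Type*} [CommRing R] [Fintype R] [DecidableEq R] (a : R) :
    Matrix R R ℂ :=
  fun y x => if y = x + a then 1 else 0

/-- The one-qudit phase operator `Z(b)` on `ℂ^d`. -/
noncomputable def ZM1 {R : Type*} [CommRing R] [Fintype R] [DecidableEq R]
    (χ : AddChar R ℂ) (b : R) : Matrix R R ℂ :=
  Matrix.diagonal fun x => χ (b * x)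

/-- The one-qudit Pauli group `P₁ = {ω^ℓ X(a)Z(b)}`, as a set of `d × d` matrices. -/
noncomputable def PauliSet1 {R : Type*} [CommRing R] [Fintype R] [DecidableEq R]
    (χ : AddChar R ℂ) (ω : ℂ) : Set (Matrix R R ℂ) :=
  {M | ∃ (ℓ : ℤ) (a b : R), M = ω ^ ℓ • (XM1 a * ZM1 χ b)}

/-- The Kronecker product `U₁ ⊗ ⋯ ⊗ U_n`, in the basis `{v_x : x ∈ R^n}`. -/
noncomputable def kron {R : Type*} [Fintype R] {n : ℕ} (Us : Fin n → Matrix R R ℂ) :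
    Matrix (Fin n → R) (Fin n → R) ℂ :=
  fun x y => ∏ i, Us i (x i) (y i)

/-- `S` is a stabilizer: an abelian subgroup of the Pauli group `P_n` meeting
the kernel `{ω^ℓ I}` of `Ψ` only in `I`. -/
noncomputable def IsStabilizer {R : Type*} [CommRing R] [Fintype R] [DecidableEq R] {n : ℕ}
    (χ : AddChar R ℂ) (ω : ℂ) (S : Set (Matrix (Fin n → R) (Fin n → R) ℂ)) : Prop :=
  S ⊆ PauliSet χ ω ∧
  (1 : Matrix (Fin n → R) (Fin n → R) ℂ) ∈ S ∧
  (∀ P ∈ S, ∀ Q ∈ S, P * Q ∈ S) ∧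
  (∀ P ∈ S, ∀ Q ∈ S, P * Q = Q * P) ∧
  (∀ P ∈ S, ∃ Q ∈ S, P * Q = 1) ∧
  (∀ P ∈ S, (∃ ℓ : ℤ, P = ω ^ ℓ • (1 : Matrix (Fin n → R) (Fin n → R) ℂ)) → P = 1)

/-- The stabilizer code `Ψ(S) ⊆ R^{2n}` associated to `S`. -/
noncomputable def PsiIm {R : Type*} [CommRing R] [Fintype R] [DecidableEq R] {n : ℕ}
    (χ : AddChar R ℂ) (ω : ℂ) (S : Set (Matrix (Fin n → R) (Fin n → R) ℂ)) :
    Set ((Fin n → R) × (Fin n → R)) :=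
  {p | ∃ ℓ : ℤ, ω ^ ℓ • (XM p.1 * ZM χ p.2) ∈ S}

/-- The symplectic inner product on `R^{2n} = R^n × R^n`. -/
def sympForm {R : Type*} [CommRing R] {n : ℕ}
    (v w : (Fin n → R) × (Fin n → R)) : R :=
  v.2 ⬝ᵥ w.1 - w.2 ⬝ᵥ v.1

/-- The symplectic weight on `R^{2n} = R^n × R^n`. -/
def sympWt {R : Type*} [CommRing R] [DecidableEq R] {n : ℕ}
    (v : (Fin n → R) × (Fin n → R)) : ℕ :=
  (Finset.univ.filter fun i : Fin n => ¬(v.1 i = 0 ∧ v.2 i = 0)).card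

theorem kron_mul_kron {R : Type*} [Fintype R] {n : ℕ}
    (A B : Fin n → Matrix R R ℂ) :
    kron A * kron B = kron fun i => A i * B i := by
  classical
  ext y x
  simp only [kron, Matrix.mul_apply, ← Finset.prod_mul_distrib]
  exact (Fintype.prod_sum fun i z => A i (y i) z * B i z (x i)).symm

theorem kron_conjTranspose {R : Type*} [Fintype R] {n : ℕ} (A : Fin n → Matrix R R ℂ) :
    (kron A)ᴴ = kron fun i => (A i)ᴴ := by
  ext y x
  simp [kron, Matrix.conjTranspose_apply]

theorem kron_smul {R : Type*} [Fintype R] {n : ℕ} (c : Fin n → ℂ)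
    (A : Fin n → Matrix R R ℂ) :
    (kron fun i => c i • A i) = (∏ i, c i) • kron A := by
  ext y x
  simp [kron, Finset.prod_mul_distrib]

theorem prod_zpow_eq_zpow_sum {ι G : Type*} [CommGroupWithZero G] {a : G} (ha : a ≠ 0)
    (s : Finset ι) (f : ι → ℤ) : ∏ i ∈ s, a ^ f i = a ^ ∑ i ∈ s, f i := by
  classical
  induction s using Finset.induction_on with
  | empty => simp
  | insert i s hi ih => rw [Finset.prod_insert hi, Finset.sum_insert hi, ih, zpow_add₀ ha]

section LocalClifford

variable {R : Type*} [CommRing R] [Fintype R] [DecidableEq R] {n : ℕ} {χ : AddChar R ℂ} {ω : ℂ}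

theorem XM1_mul_ZM1_apply (χ : AddChar R ℂ) (a b y x : R) :
    (XM1 a * ZM1 χ b) y x = if y = x + a then χ (b * x) else 0 := by
  simp [XM1, ZM1, Matrix.mul_diagonal]

theorem XM_mul_ZM_apply (χ : AddChar R ℂ) (a b y x : Fin n → R) :
    (XM a * ZM χ b) y x = if y = x + a then χ (b ⬝ᵥ x) else 0 := by
  simp [XM, ZM, Matrix.mul_diagonal]

theorem XM1_mul_ZM1_zero : XM1 0 * ZM1 χ 0 = 1 := by
  ext y x
  simp [XM1_mul_ZM1_apply, Matrix.one_apply]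

theorem XM1_mul_ZM1_mul (p q : R × R) :
    (XM1 p.1 * ZM1 χ p.2) * (XM1 q.1 * ZM1 χ q.2) =
      χ (p.2 * q.1) • (XM1 (p + q).1 * ZM1 χ (p + q).2) := by
  ext y x
  rw [Matrix.mul_apply, Finset.sum_eq_single (x + q.1)]
  · simp only [XM1_mul_ZM1_apply, Matrix.smul_apply, if_true, Prod.fst_add, Prod.snd_add,
      show x + q.1 + p.1 = x + (p.1 + q.1) by ring, smul_eq_mul]
    split_ifs
    · rw [← AddChar.map_add_eq_mul, ← AddChar.map_add_eq_mul]
      congr 1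
      ring
    · simp
  · intro z _ hz
    simp [XM1_mul_ZM1_apply, hz]
  · simp

theorem eq_of_smul_XM1_mul_ZM1_eq (hχ : Function.Injective χ) {c c' : ℂ} (hc : c ≠ 0)
    {p q : R × R} (h : c • (XM1 p.1 * ZM1 χ p.2) = c' • (XM1 q.1 * ZM1 χ q.2)) :
    p = q ∧ c = c' := by
  have entry (y x : R) := congrFun (congrFun h y) x
  simp only [Matrix.smul_apply, XM1_mul_ZM1_apply, smul_eq_mul] at entry
  have h0 := entry p.1 0
  have h1 : p.1 = q.1 := by
    by_contra hne
    simp [hne, hc] at h0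
  have hcc : c = c' := by simpa [h1] using h0
  subst hcc
  refine ⟨Prod.ext h1 (hχ ?_), rfl⟩
  simpa [h1, hc] using entry (1 + p.1) 1

theorem eq_of_smul_XM_mul_ZM_eq (hχ : Function.Injective χ) {c c' : ℂ} (hc : c ≠ 0)
    {p q : (Fin n → R) × (Fin n → R)}
    (h : c • (XM p.1 * ZM χ p.2) = c' • (XM q.1 * ZM χ q.2)) : p = q := by
  have entry (y x : Fin n → R) := congrFun (congrFun h y) x
  simp only [Matrix.smul_apply, XM_mul_ZM_apply, smul_eq_mul] at entry
  have h0 := entry p.1 0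
  have h1 : p.1 = q.1 := by
    by_contra hne
    simp [hne, hc] at h0
  have hcc : c = c' := by simpa [h1] using h0
  subst hcc
  refine Prod.ext h1 (funext fun i => hχ ?_)
  have hi := entry (Pi.single i 1 + p.1) (Pi.single i 1)
  rw [if_pos rfl, if_pos (by rw [h1])] at hi
  simpa [hc] using hi

theorem XM_mul_ZM_eq_kron (χ : AddChar R ℂ) (a b : Fin n → R) :
    XM a * ZM χ b = kron fun i => XM1 (a i) * ZM1 χ (b i) := by
  ext y x
  simp only [XM_mul_ZM_apply, kron, XM1_mul_ZM1_apply]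
  split_ifs with h
  · subst h
    simp only [if_true, Pi.add_apply]
    exact map_prod χ.toMonoidHom (fun i => Multiplicative.ofAdd (b i * x i)) Finset.univ
  · obtain ⟨i, hi⟩ := Function.ne_iff.mp h
    exact (Finset.prod_eq_zero (Finset.mem_univ i) (if_neg hi)).symm

/-- Conjugation by a one-qudit Clifford operator acts on `R × R`, modulo phases, by an injective
additive map which preserves the symplectic form. -/
theorem exists_addMonoidHom_of_clifford (hχ : Function.Injective χ) (hω : ω ≠ 0)
    {U : Matrix R R ℂ} (hU : U ∈ Matrix.unitaryGroup R ℂ)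
    (hP : (fun P => U * P * Uᴴ) '' PauliSet1 χ ω = PauliSet1 χ ω) :
    ∃ f : R × R →+ R × R, Function.Injective f ∧
      (∀ p q, (f p).2 * (f q).1 - (f q).2 * (f p).1 = p.2 * q.1 - q.2 * p.1) ∧
      ∀ p, ∃ ℓ : ℤ, U * (XM1 p.1 * ZM1 χ p.2) * Uᴴ = ω ^ ℓ • (XM1 (f p).1 * ZM1 χ (f p).2) := by
  have hUU : Uᴴ * U = 1 := Matrix.mem_unitaryGroup_iff'.mp hU
  have hUU' : U * Uᴴ = 1 := Matrix.mem_unitaryGroup_iff.mp hU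
  have conj_mul (A B : Matrix R R ℂ) : U * A * Uᴴ * (U * B * Uᴴ) = U * (A * B) * Uᴴ := by
    calc _ = U * A * (Uᴴ * U) * B * Uᴴ := by simp only [mul_assoc]
      _ = _ := by rw [hUU]; simp only [mul_assoc, one_mul]
  have image (p : R × R) : ∃ (q : R × R) (ℓ : ℤ),
      U * (XM1 p.1 * ZM1 χ p.2) * Uᴴ = ω ^ ℓ • (XM1 q.1 * ZM1 χ q.2) := by
    obtain ⟨ℓ, a, b, h⟩ := hP.subset ⟨XM1 p.1 * ZM1 χ p.2, ⟨0, p.1, p.2, by simp⟩, rfl⟩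
    exact ⟨(a, b), ℓ, h⟩
  choose f ℓ hf using image
  have hne (k : ℤ) : ω ^ k ≠ 0 := zpow_ne_zero k hω
  have hχne (x : R) : χ x ≠ 0 := (χ.val_isUnit x).ne_zero
  have product (p q : R × R) :
      (ω ^ ℓ p * ω ^ ℓ q * χ ((f p).2 * (f q).1)) • (XM1 (f p + f q).1 * ZM1 χ (f p + f q).2) =
        (χ (p.2 * q.1) * ω ^ ℓ (p + q)) • (XM1 (f (p + q)).1 * ZM1 χ (f (p + q)).2) := by
    have h := conj_mul (XM1 p.1 * ZM1 χ p.2) (XM1 q.1 * ZM1 χ q.2)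
    rw [XM1_mul_ZM1_mul, hf, hf, Matrix.smul_mul, Matrix.mul_smul, XM1_mul_ZM1_mul,
      Matrix.mul_smul, Matrix.smul_mul, hf] at h
    simpa only [smul_smul, mul_assoc] using h
  have compare (p q : R × R) := eq_of_smul_XM1_mul_ZM1_eq hχ
    (mul_ne_zero (mul_ne_zero (hne _) (hne _)) (hχne _)) (product p q)
  let F : R × R →+ R × R := AddMonoidHom.mk' f fun p q => (compare p q).1.symm
  refine ⟨F, (injective_iff_map_eq_zero F).mpr fun p hp => ?_, fun p q => hχ ?_,
    fun p => ⟨ℓ p, hf p⟩⟩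
  · have h := hf p
    rw [show f p = 0 from hp, Prod.fst_zero, Prod.snd_zero, XM1_mul_ZM1_zero] at h
    have h' : (1 : ℂ) • (XM1 p.1 * ZM1 χ p.2) =
        ω ^ ℓ p • (XM1 (0 : R × R).1 * ZM1 χ (0 : R × R).2) := by
      calc _ = Uᴴ * (U * (XM1 p.1 * ZM1 χ p.2) * Uᴴ) * U := by
            calc _ = (Uᴴ * U) * (XM1 p.1 * ZM1 χ p.2) * (Uᴴ * U) := by simp [hUU]
              _ = _ := by simp only [mul_assoc]
        _ = _ := by
            rw [h]
            simp [XM1_mul_ZM1_zero, hUU]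
    exact (eq_of_smul_XM1_mul_ZM1_eq hχ one_ne_zero h').1
  · have h₁ := (compare p q).2
    have h₂ := (compare q p).2
    rw [add_comm q p] at h₂
    simp only [AddChar.map_sub_eq_div]
    rw [div_eq_div_iff (hχne _) (hχne _)]
    apply mul_left_cancel₀ (mul_ne_zero (mul_ne_zero (hne (ℓ p)) (hne (ℓ q))) (hne (ℓ (p + q))))
    change _ * (χ ((f p).2 * (f q).1) * _) = _ * (_ * χ ((f q).2 * (f p).1))
    linear_combination ω ^ ℓ (p + q) * χ (q.2 * p.1) * h₁ - ω ^ ℓ (p + q) * χ (p.2 * q.1) * h₂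

end LocalClifford

theorem ZMod.injective_of_eq_exp {d : ℕ} [NeZero d] {χ : AddChar (ZMod d) ℂ}
    (hχ : ∀ x : ZMod d,
      χ x = Complex.exp (2 * Real.pi * Complex.I * (x.val : ℂ) / (d : ℂ))) :
    Function.Injective χ := by
  have h : χ = ZMod.stdAddChar := by
    ext x
    rw [hχ, ZMod.stdAddChar_apply, ZMod.toCircle_apply]
  rw [h]
  exact ZMod.injective_stdAddChar

/-- Over `R = ℤ/dℤ`, if `S` is a stabilizer with stabilizer code
`C = Ψ(S)` and `U = U₁ ⊗ ⋯ ⊗ U_n` is a local Clifford operator (each `U_i` unitary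
with `U_i P₁ U_i† = P₁`), then `C` and `C_U = Ψ(U S U†)` are symplectically isometric:
there is an `R`-linear bijection `C → C_U` preserving the symplectic weight and the
symplectic inner product. -/
theorem stmt17 (d : ℕ) [NeZero d] {n : ℕ}
    (χ : AddChar (ZMod d) ℂ)
    (hχ : ∀ x : ZMod d,
      χ x = Complex.exp (2 * Real.pi * Complex.I * (x.val : ℂ) / (d : ℂ)))
    (ω : ℂ) (hω : IsPrimitiveRoot ω (if d % 2 = 1 then d else 2 * d))
    (S : Set (Matrix (Fin n → ZMod d) (Fin n → ZMod d) ℂ))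
    (hS : IsStabilizer χ ω S)
    (Us : Fin n → Matrix (ZMod d) (ZMod d) ℂ)
    (hUs : ∀ i, Us i ∈ Matrix.unitaryGroup (ZMod d) ℂ)
    (hCliff : ∀ i, (fun P => Us i * P * (Us i)ᴴ) '' PauliSet1 χ ω = PauliSet1 χ ω) :
    ∃ φ : PsiIm χ ω S → PsiIm χ ω ((fun P => kron Us * P * (kron Us)ᴴ) '' S),
      Function.Bijective φ ∧
      (∀ (v w : PsiIm χ ω S) (h : (v : (Fin n → ZMod d) × (Fin n → ZMod d)) +
            (w : (Fin n → ZMod d) × (Fin n → ZMod d)) ∈ PsiIm χ ω S),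
        (φ ⟨(v : (Fin n → ZMod d) × (Fin n → ZMod d)) +
              (w : (Fin n → ZMod d) × (Fin n → ZMod d)), h⟩ :
            (Fin n → ZMod d) × (Fin n → ZMod d)) =
          (φ v : (Fin n → ZMod d) × (Fin n → ZMod d)) +
          (φ w : (Fin n → ZMod d) × (Fin n → ZMod d))) ∧
      (∀ (r : ZMod d) (v : PsiIm χ ω S)
          (h : r • (v : (Fin n → ZMod d) × (Fin n → ZMod d)) ∈ PsiIm χ ω S),
        (φ ⟨r • (v : (Fin n → ZMod d) × (Fin n → ZMod d)), h⟩ :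
            (Fin n → ZMod d) × (Fin n → ZMod d)) =
          r • (φ v : (Fin n → ZMod d) × (Fin n → ZMod d))) ∧
      (∀ v : PsiIm χ ω S,
        sympWt (φ v : (Fin n → ZMod d) × (Fin n → ZMod d)) =
          sympWt (v : (Fin n → ZMod d) × (Fin n → ZMod d))) ∧
      (∀ v w : PsiIm χ ω S,
        sympForm (φ v : (Fin n → ZMod d) × (Fin n → ZMod d))
            (φ w : (Fin n → ZMod d) × (Fin n → ZMod d)) =
          sympForm (v : (Fin n → ZMod d) × (Fin n → ZMod d))
            (w : (Fin n → ZMod d) × (Fin n → ZMod d))) := by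
  have hχi := ZMod.injective_of_eq_exp hχ
  have hω0 : ω ≠ 0 := hω.ne_zero (by have := NeZero.ne d; split_ifs <;> omega)
  choose f hinj hform hconj using
    fun i => exists_addMonoidHom_of_clifford hχi hω0 (hUs i) (hCliff i)
  let F : (Fin n → ZMod d) × (Fin n → ZMod d) → (Fin n → ZMod d) × (Fin n → ZMod d) :=
    fun p => (fun i => (f i (p.1 i, p.2 i)).1, fun i => (f i (p.1 i, p.2 i)).2)
  have hFconj (p : (Fin n → ZMod d) × (Fin n → ZMod d)) : ∃ ℓ : ℤ,
      kron Us * (XM p.1 * ZM χ p.2) * (kron Us)ᴴ = ω ^ ℓ • (XM (F p).1 * ZM χ (F p).2) := by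
    choose ℓ hℓ using fun i => hconj i (p.1 i, p.2 i)
    refine ⟨∑ i, ℓ i, ?_⟩
    rw [XM_mul_ZM_eq_kron, XM_mul_ZM_eq_kron, kron_conjTranspose, kron_mul_kron, kron_mul_kron]
    simp only [hℓ]
    rw [kron_smul, prod_zpow_eq_zpow_sum hω0]
  have hFmem (p : (Fin n → ZMod d) × (Fin n → ZMod d)) (hp : p ∈ PsiIm χ ω S) :
      F p ∈ PsiIm χ ω ((fun P => kron Us * P * (kron Us)ᴴ) '' S) := by
    obtain ⟨k, hk⟩ := hp
    obtain ⟨ℓ, hℓ⟩ := hFconj p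
    refine ⟨k + ℓ, _, hk, ?_⟩
    simp only [Matrix.mul_smul, Matrix.smul_mul, hℓ, smul_smul, zpow_add₀ hω0]
  refine ⟨fun v => ⟨F v, hFmem v v.2⟩, ⟨fun v w h => Subtype.ext ?_, ?_⟩, ?_, ?_, ?_, ?_⟩
  · have hvw : F v = F w := congrArg Subtype.val h
    have key (i : Fin n) := hinj i (Prod.ext (congrFun (congrArg Prod.fst hvw) i)
      (congrFun (congrArg Prod.snd hvw) i))
    exact Prod.ext (funext fun i => congrArg Prod.fst (key i))
      (funext fun i => congrArg Prod.snd (key i))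
  · rintro ⟨q, k, P, hPS, hP⟩
    obtain ⟨ℓ, a, b, rfl⟩ := hS.1 hPS
    obtain ⟨m, hm⟩ := hFconj (a, b)
    refine ⟨⟨(a, b), ℓ, hPS⟩, Subtype.ext ?_⟩
    simp only [Matrix.mul_smul, Matrix.smul_mul, hm, smul_smul] at hP
    exact eq_of_smul_XM_mul_ZM_eq hχi (mul_ne_zero (zpow_ne_zero _ hω0) (zpow_ne_zero _ hω0)) hP
  · intro v w h
    have key (i : Fin n) := map_add (f i) (v.1.1 i, v.1.2 i) (w.1.1 i, w.1.2 i)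
    exact Prod.ext (funext fun i => congrArg Prod.fst (key i))
      (funext fun i => congrArg Prod.snd (key i))
  · intro r v h
    have key (i : Fin n) := ZMod.map_smul (f i) r (v.1.1 i, v.1.2 i)
    exact Prod.ext (funext fun i => congrArg Prod.fst (key i))
      (funext fun i => congrArg Prod.snd (key i))
  · intro v
    have key (i : Fin n) := map_eq_zero_iff (f i) (hinj i) (x := (v.1.1 i, v.1.2 i))
    simp only [Prod.ext_iff, Prod.fst_zero, Prod.snd_zero] at key
    simp only [sympWt, F, key]
  · intro v w
    simp only [sympForm, dotProduct, ← Finset.sum_sub_distrib, F, hform]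
end
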